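/- arXiv:1004.1879 — 5 statements merged into one kernel-verified Lean document; each statement's English description precedes it below -/
import Mathlib

section
/- Every Q-point has nonempty intersection with the van der Waerden ideal: if 𝒰 is a Q-point on ℕ, then there exists U ∈ 𝒰 that is not an AP-set. -/
open Set Filter Cardinal

/-- A set `A ⊆ ℕ` is an AP-set if it contains arithmetic progressions of every finite length. -/
def IsAPSet (A : Set ℕ) : Prop :=
  ∀ k : ℕ, ∃ a d : ℕ, 1 ≤ d ∧ ∀ i < k, a + i * d ∈ A

/-- `A` contains a 3-term arithmetic progression `{a, a+d, a+2d}` with `d ≥ 1`. -/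
def Has3AP (A : Set ℕ) : Prop :=
  ∃ a d : ℕ, 1 ≤ d ∧ a ∈ A ∧ a + d ∈ A ∧ a + 2 * d ∈ A

/-- `f` is finite-to-one: each fiber is finite. -/
def FiniteToOne (f : ℕ → ℕ) : Prop := ∀ m : ℕ, (f ⁻¹' {m}).Finite

/-- A nonprincipal ultrafilter `𝒰` on ℕ is a Q-point if for every partition of ℕ into finite
sets there is a member of `𝒰` meeting each piece in at most one point. -/
def IsQPoint (𝒰 : Ultrafilter ℕ) : Prop :=
  (∀ a : ℕ, 𝒰 ≠ pure a) ∧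
    ∀ Q : ℕ → Set ℕ, (∀ n, (Q n).Finite) →
      (∀ m n, m ≠ n → Disjoint (Q m) (Q n)) → (⋃ n, Q n) = Set.univ →
      ∃ A ∈ 𝒰, ∀ n, (A ∩ Q n).Subsingleton

/-- A filter base on ℕ. -/
def IsFilterBase (𝓕 : Set (Set ℕ)) : Prop :=
  𝓕.Nonempty ∧ ∀ A ∈ 𝓕, ∀ B ∈ 𝓕, ∃ C ∈ 𝓕, C ⊆ A ∩ B

/-- Property (♠): every member of the family has at least `k` elements in some dyadic
interval `[2ⁿ, 2ⁿ⁺¹)`, for every `k`. -/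
def Spade (𝓕 : Set (Set ℕ)) : Prop :=
  ∀ F ∈ 𝓕, ∀ k : ℕ, ∃ n : ℕ, k ≤ (F ∩ Set.Ico (2 ^ n) (2 ^ (n + 1))).ncard

/-- A dense subset of a poset. -/
def PosetDense {P : Type} [PartialOrder P] (D : Set P) : Prop :=
  ∀ p : P, ∃ q ∈ D, q ≤ p

/-- A filter on a poset: nonempty, upward closed, downward directed. -/
def PosetFilter {P : Type} [PartialOrder P] (G : Set P) : Prop :=
  G.Nonempty ∧ (∀ p ∈ G, ∀ q, p ≤ q → q ∈ G) ∧
    ∀ p ∈ G, ∀ q ∈ G, ∃ r ∈ G, r ≤ p ∧ r ≤ q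

/-- Martin's axiom for countable posets. -/
def MActble : Prop :=
  ∀ (P : Type) [PartialOrder P] [Countable P] [Nonempty P],
    ∀ 𝒟 : Set (Set P), (∀ D ∈ 𝒟, PosetDense D) → #𝒟 < Cardinal.continuum →
      ∃ G : Set P, PosetFilter G ∧ ∀ D ∈ 𝒟, (G ∩ D).Nonempty

/-- A rapid ultrafilter: the enumeration functions of its members form a dominating family. -/
def IsRapid (𝒰 : Ultrafilter ℕ) : Prop :=
  ∀ h : ℕ → ℕ, ∃ B ∈ 𝒰, B.Infinite ∧ ∀ᶠ n in Filter.atTop, h n ≤ Nat.nth (· ∈ B) n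

/-- A hereditarily rapid ultrafilter: all its images under maps `ℕ → ℕ` are rapid. -/
def IsHereditarilyRapid (𝒰 : Ultrafilter ℕ) : Prop :=
  IsRapid 𝒰 ∧ ∀ f : ℕ → ℕ, IsRapid (Ultrafilter.map f 𝒰)

/-- A set with at most one element of each binary length contains no arithmetic progression of
length five. -/
theorem not_isAPSet_of_injOn_size {A : Set ℕ} (hA : Set.InjOn Nat.size A) : ¬ IsAPSet A := by
  intro h
  obtain ⟨a, d, hd, hmem⟩ := h 5
  have size_lt : ∀ i, i + 1 < 5 → Nat.size (a + i * d) < Nat.size (a + (i + 1) * d) := by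
    intro i hi
    have hlt : a + i * d < a + (i + 1) * d := by nlinarith
    exact lt_of_le_of_ne (Nat.size_le_size hlt.le) fun heq =>
      hlt.ne (hA (hmem i (by omega)) (hmem (i + 1) hi) heq)
  have h₁ := size_lt 1 (by norm_num)
  have h₂ := size_lt 2 (by norm_num)
  have h₃ := size_lt 3 (by norm_num)
  norm_num at h₁ h₂ h₃
  have hub := Nat.lt_size_self (a + d)
  have hlb : 2 ^ (Nat.size (a + d) + 2) ≤ a + 4 * d := Nat.lt_size.1 (by omega)
  rw [pow_add] at hlb
  omega

/-- Every Q-point has nonempty intersection with the van der Waerden ideal. -/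
theorem qpoint_meets_vdW_ideal (𝒰 : Ultrafilter ℕ) (hQ : IsQPoint 𝒰) :
    ∃ U ∈ 𝒰, ¬ IsAPSet U := by
  obtain ⟨A, hA, hsub⟩ := hQ.2 (fun n => Nat.size ⁻¹' {n})
    (fun n => (Set.finite_Iio (2 ^ n)).subset fun _ hx => Nat.size_le.1 (le_of_eq hx))
    (fun _ _ hmn => (Set.disjoint_singleton.2 hmn).preimage _)
    (Set.eq_univ_of_forall fun x => Set.mem_iUnion.2 ⟨Nat.size x, rfl⟩)
  exact ⟨A, hA, not_isAPSet_of_injOn_size fun x hx y hy hxy =>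
    hsub (Nat.size y) ⟨hx, hxy⟩ ⟨hy, rfl⟩⟩
end

section
/- Let f : ℕ → ℕ and F ⊆ ℕ be such that for every finite K ⊆ ℕ and every k ∈ ℕ there exists n ∈ ℕ with |(F ∖ f⁻¹[K]) ∩ [2ⁿ, 2ⁿ⁺¹)| ≥ k. Then for every finite set L ⊆ ℕ such that f[L] contains no 3-term arithmetic progression and every k ≥ 1, there exists a finite set K ⊆ ℕ with L ⊊ K, every element of K ∖ L greater than every element of L, f[K] containing no 3-term arithmetic progression, and such that |K ∩ F ∩ [2ⁿ, 2ⁿ⁺¹)| ≥ k for some n ∈ ℕ. (This is the density of the sets D_{F,k} in the forcing poset used to prove the existence, under MA_ctble, of a 𝒲-ultrafilter that is not a Q-point.) -/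
open Set Filter Cardinal

/-- The points completing a pair of elements of `T` (possibly equal) to a 3-term progression. -/
def apCompletions (T : Finset ℕ) : Finset ℕ :=
  (T ×ˢ T).image (fun p => 2 * p.1 - p.2) ∪ (T ×ˢ T).image (fun p => (p.1 + p.2) / 2)

lemma card_apCompletions_le (T : Finset ℕ) : (apCompletions T).card ≤ 2 * T.card ^ 2 := by
  have h₁ := Finset.card_image_le (s := T ×ˢ T) (f := fun p : ℕ × ℕ => 2 * p.1 - p.2)
  have h₂ := Finset.card_image_le (s := T ×ˢ T) (f := fun p : ℕ × ℕ => (p.1 + p.2) / 2)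
  rw [Finset.card_product] at h₁ h₂
  refine (Finset.card_union_le _ _).trans ?_
  linarith

lemma two_mul_sub_mem_apCompletions {T : Finset ℕ} {a b x : ℕ} (ha : a ∈ T) (hb : b ∈ T)
    (hx : x + b = 2 * a) : x ∈ apCompletions T :=
  Finset.mem_union_left _ (Finset.mem_image.2
    ⟨(a, b), Finset.mk_mem_product ha hb, by dsimp only; omega⟩)

lemma midpoint_mem_apCompletions {T : Finset ℕ} {a b x : ℕ} (ha : a ∈ T) (hb : b ∈ T)
    (hx : 2 * x = a + b) : x ∈ apCompletions T :=
  Finset.mem_union_right _ (Finset.mem_image.2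
    ⟨(a, b), Finset.mk_mem_product ha hb, by dsimp only; omega⟩)

lemma subset_apCompletions (T : Finset ℕ) : T ⊆ apCompletions T := fun _ hx =>
  two_mul_sub_mem_apCompletions hx hx (two_mul _).symm

lemma not_has3AP_insert {T : Finset ℕ} {x : ℕ} (hT : ¬ Has3AP (T : Set ℕ))
    (hx : x ∉ apCompletions T) : ¬ Has3AP ((insert x T : Finset ℕ) : Set ℕ) := by
  rintro ⟨a, d, hd, h₀, h₁, h₂⟩
  rw [Finset.mem_coe, Finset.mem_insert] at h₀ h₁ h₂
  rcases h₀ with h₀ | h₀ <;> rcases h₁ with h₁ | h₁ <;> rcases h₂ with h₂ | h₂ <;> try omega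
  · exact hx (two_mul_sub_mem_apCompletions h₁ h₂ (by omega))
  · exact hx (midpoint_mem_apCompletions h₀ h₂ (by omega))
  · exact hx (two_mul_sub_mem_apCompletions h₁ h₀ (by omega))
  · exact hT ⟨a, d, hd, h₀, h₁, h₂⟩

/-- A large enough finite set contains `k` points that can be added to `T` without creating
a 3-term progression. -/
lemma exists_subset_not_has3AP_union {T : Finset ℕ} (hT : ¬ Has3AP (T : Set ℕ)) (V : Finset ℕ)
    (k : ℕ) (hV : 2 * (T.card + k) ^ 2 < V.card) :
    ∃ S ⊆ V, S.card = k ∧ ¬ Has3AP ((T ∪ S : Finset ℕ) : Set ℕ) := by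
  induction k with
  | zero => exact ⟨∅, Finset.empty_subset _, rfl, by simpa using hT⟩
  | succ k ih =>
    obtain ⟨S, hSV, hS, hTS⟩ := ih (lt_of_le_of_lt (by gcongr; omega) hV)
    have hcard : (apCompletions (T ∪ S)).card < V.card := by
      refine lt_of_le_of_lt ((card_apCompletions_le _).trans ?_) hV
      have := Finset.card_union_le T S
      gcongr
      omega
    obtain ⟨v, hv, hvT⟩ := Finset.exists_mem_notMem_of_card_lt_card hcard
    have hvS : v ∉ S := fun h =>
      hvT (subset_apCompletions _ (Finset.mem_union_right _ h))
    refine ⟨insert v S, Finset.insert_subset hv hSV, ?_, ?_⟩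
    · rw [Finset.card_insert_of_notMem hvS, hS]
    · rw [Finset.union_insert]
      exact not_has3AP_insert hTS hvT

/-- A large enough finite set whose image avoids the completions of `T` has a subset with at
least `k` elements whose image can be added to `T` without creating a 3-term progression. -/
lemma exists_subset_not_has3AP_union_image (f : ℕ → ℕ) {T : Finset ℕ}
    (hT : ¬ Has3AP (T : Set ℕ)) (X : Finset ℕ) {k : ℕ} (hk : 1 ≤ k)
    (hX : 2 * (T.card + k) ^ 2 * k ≤ X.card) (hf : ∀ x ∈ X, f x ∉ apCompletions T) :
    ∃ Y ⊆ X, k ≤ Y.card ∧ ¬ Has3AP ((T ∪ Y.image f : Finset ℕ) : Set ℕ) := by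
  rcases lt_or_ge (2 * (T.card + k) ^ 2) (X.image f).card with hV | hV
  · obtain ⟨S, hSV, hS, hTS⟩ := exists_subset_not_has3AP_union hT _ k hV
    obtain ⟨Y, hY, rfl⟩ := Finset.subset_image_iff.1 hSV
    exact ⟨Y, mod_cast hY, hS ▸ Finset.card_image_le, hTS⟩
  · have hne : X.Nonempty := Finset.card_pos.1 (lt_of_lt_of_le (by positivity) hX)
    obtain ⟨v, hv, hvk⟩ := Finset.exists_le_card_fiber_of_mul_le_card_of_maps_to
      (fun x hx => Finset.mem_image_of_mem f hx) (hne.image f)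
      ((Nat.mul_le_mul_right k hV).trans hX)
    have himage : (X.filter (f · = v)).image f = {v} := by
      obtain ⟨x, hx, rfl⟩ := Finset.mem_image.1 hv
      ext y
      simp only [Finset.mem_image, Finset.mem_filter, Finset.mem_singleton]
      constructor
      · rintro ⟨z, ⟨-, hz⟩, rfl⟩
        exact hz
      · rintro rfl
        exact ⟨x, ⟨hx, rfl⟩, rfl⟩
    refine ⟨X.filter (f · = v), Finset.filter_subset _ _, hvk, ?_⟩
    obtain ⟨x, hx, rfl⟩ := Finset.mem_image.1 hv
    rw [himage, Finset.union_comm, ← Finset.insert_eq]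
    exact not_has3AP_insert hT (hf x hx)

/-- Density of the sets `D_{F,k}` in the poset of finite sets whose `f`-image
contains no 3-term arithmetic progression. -/
theorem density_DFk_for_W_not_Qpoint (f : ℕ → ℕ) (F : Set ℕ)
    (hF : ∀ K : Finset ℕ, ∀ k : ℕ,
      ∃ n : ℕ, k ≤ ((F \ f ⁻¹' (↑K : Set ℕ)) ∩ Set.Ico (2 ^ n) (2 ^ (n + 1))).ncard)
    (L : Finset ℕ) (hL : ¬ Has3AP (f '' (↑L : Set ℕ))) (k : ℕ) (hk : 1 ≤ k) :
    ∃ K : Finset ℕ, L ⊂ K ∧ (∀ x ∈ K, x ∉ L → ∀ y ∈ L, y < x) ∧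
      ¬ Has3AP (f '' (↑K : Set ℕ)) ∧
      ∃ n : ℕ, k ≤ ((↑K ∩ F) ∩ Set.Ico (2 ^ n) (2 ^ (n + 1))).ncard := by
  classical
  have hT : ¬ Has3AP ((L.image f : Finset ℕ) : Set ℕ) := by rwa [Finset.coe_image]
  obtain ⟨n, hn⟩ := hF (apCompletions (L.image f) ∪ (Finset.range (L.sup id + 1)).image f)
    (2 * ((L.image f).card + k) ^ 2 * k)
  have hfin := (Set.finite_Ico (2 ^ n) (2 ^ (n + 1))).inter_of_right
    (F \ f ⁻¹' ((apCompletions (L.image f) ∪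
      (Finset.range (L.sup id + 1)).image f : Finset ℕ) : Set ℕ))
  rw [Set.ncard_eq_toFinset_card _ hfin] at hn
  obtain ⟨Y, hYX, hYk, hY⟩ := exists_subset_not_has3AP_union_image f hT _ hk hn fun x hx h =>
    (hfin.mem_toFinset.1 hx).1.2 (Finset.mem_union_left _ h)
  have hmem : ∀ x ∈ Y, x ∈ F ∧ x ∈ Set.Ico (2 ^ n) (2 ^ (n + 1)) := fun x hx =>
    have h := hfin.mem_toFinset.1 (hYX hx)
    ⟨h.1.1, h.2⟩
  have hlt : ∀ x ∈ Y, ∀ y ∈ L, y < x := by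
    intro x hx y hy
    by_contra! hxy
    have hyL : y ≤ L.sup id := Finset.le_sup (f := id) hy
    exact (hfin.mem_toFinset.1 (hYX hx)).1.2 (Finset.mem_union_right _
      (Finset.mem_image_of_mem f (Finset.mem_range.2 (by omega))))
  obtain ⟨y, hy⟩ := Finset.card_pos.1 (hk.trans hYk)
  refine ⟨L ∪ Y, ?_, ?_, ?_, n, ?_⟩
  · exact Finset.ssubset_iff_subset_ne.2 ⟨Finset.subset_union_left, fun h =>
      lt_irrefl y (hlt y hy y (h ▸ Finset.mem_union_right L hy))⟩
  · intro x hx hxL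
    exact hlt x ((Finset.mem_union.1 hx).resolve_left hxL)
  · rwa [← Finset.coe_image, Finset.image_union]
  · rw [← Set.ncard_coe_finset] at hYk
    refine hYk.trans (Set.ncard_le_ncard (fun x hx => ?_)
      ((Set.finite_Ico _ _).inter_of_right _))
    exact ⟨⟨Finset.mem_coe.2 (Finset.mem_union_right _ hx), (hmem x hx).1⟩, (hmem x hx).2⟩
end

section
/- Assume MA_ctble. Let g : ℕ → (0, ∞) satisfy Σₙ g(n) = ∞ and limₙ g(n) = 0, let 𝓕 be a filter base on ℕ of cardinality less than 𝔠 every member of which is an AP-set, and let f : ℕ → ℕ. Then there exists an infinite set G ⊆ ℕ such that Σ_{a ∈ f[G]} g(a) < ∞ and F ∩ G is an AP-set for every F ∈ 𝓕. -/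
open Set Filter Cardinal

theorem IsAPSet.mono {A B : Set ℕ} (hA : IsAPSet A) (h : A ⊆ B) : IsAPSet B := fun k ↦
  let ⟨a, d, hd, hi⟩ := hA k
  ⟨a, d, hd, fun i hik ↦ h (hi i hik)⟩

theorem IsAPSet.infinite {A : Set ℕ} (hA : IsAPSet A) : A.Infinite := by
  intro hfin
  obtain ⟨M, hM⟩ := hfin.bddAbove
  obtain ⟨a, d, hd, hi⟩ := hA (M + 2)
  have h := hM (hi (M + 1) (by omega))
  nlinarith

/-- Along a combinatorial line, the coordinate sum is an arithmetic progression with positive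
common difference. -/
theorem exists_sum_line_eq {k : ℕ} {ι : Type*} [Fintype ι] (l : Combinatorics.Line (Fin k) ι) :
    ∃ b m : ℕ, 1 ≤ m ∧ ∀ x : Fin k, ∑ i, (l x i : ℕ) = b + x * m := by
  classical
  refine ⟨∑ i, (l.idxFun i).elim 0 (fun y ↦ (y : ℕ)),
    (Finset.univ.filter fun i ↦ l.idxFun i = none).card, ?_, fun x ↦ ?_⟩
  · obtain ⟨i, hi⟩ := l.proper
    exact Finset.card_pos.2 ⟨i, by simp [hi]⟩
  · rw [Finset.card_filter, Finset.mul_sum, ← Finset.sum_add_distrib]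
    refine Finset.sum_congr rfl fun i _ ↦ ?_
    cases h : l.idxFun i <;> simp [Combinatorics.Line.coe_apply, h]

/-- Van der Waerden's theorem: the AP-sets are partition regular. -/
theorem IsAPSet.or_of_union {A B : Set ℕ} (hAB : IsAPSet (A ∪ B)) : IsAPSet A ∨ IsAPSet B := by
  classical
  have key : ∀ k : ℕ, (∃ a d : ℕ, 1 ≤ d ∧ ∀ i < k, a + i * d ∈ A) ∨
      ∃ a d : ℕ, 1 ≤ d ∧ ∀ i < k, a + i * d ∈ B := by
    intro k
    obtain ⟨ι, _, hι⟩ := Combinatorics.Line.exists_mono_in_high_dimension (Fin k) Prop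
    obtain ⟨a, d, hd, hi⟩ := hAB (Fintype.card ι * k + 1)
    obtain ⟨l, c, hc⟩ := hι fun v ↦ a + (∑ i, (v i : ℕ)) * d ∈ A
    obtain ⟨b, m, hm, hsum⟩ := exists_sum_line_eq l
    have hlt (x : Fin k) : ∑ i, (l x i : ℕ) < Fintype.card ι * k + 1 := by
      refine Nat.lt_succ_of_le ?_
      simpa using Finset.sum_le_card_nsmul Finset.univ (fun i ↦ (l x i : ℕ)) k
        fun i _ ↦ (l x i).isLt.le
    have heq (x : Fin k) : a + (∑ i, (l x i : ℕ)) * d = a + b * d + x * (m * d) := by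
      rw [hsum]; ring
    have hmd : 1 ≤ m * d := Nat.mul_pos hm hd
    by_cases h : c
    · refine Or.inl ⟨a + b * d, m * d, hmd, fun i hik ↦ ?_⟩
      rw [← heq ⟨i, hik⟩]
      exact (iff_of_eq (hc ⟨i, hik⟩)).mpr h
    · refine Or.inr ⟨a + b * d, m * d, hmd, fun i hik ↦ ?_⟩
      rw [← heq ⟨i, hik⟩]
      exact (hi _ (hlt ⟨i, hik⟩)).resolve_left fun h' ↦ h ((iff_of_eq (hc ⟨i, hik⟩)).mp h')
  by_contra! hne
  obtain ⟨⟨k, hk⟩, k', hk'⟩ : (∃ k, ¬ ∃ a d : ℕ, 1 ≤ d ∧ ∀ i < k, a + i * d ∈ A) ∧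
      ∃ k, ¬ ∃ a d : ℕ, 1 ≤ d ∧ ∀ i < k, a + i * d ∈ B := by
    simpa only [IsAPSet, not_forall] using hne
  rcases key (max k k') with ⟨a, d, hd, h⟩ | ⟨a, d, hd, h⟩
  · exact hk ⟨a, d, hd, fun i hik ↦ h i (lt_max_of_lt_left hik)⟩
  · exact hk' ⟨a, d, hd, fun i hik ↦ h i (lt_max_of_lt_right hik)⟩

/-- In a filter base of AP-sets, a set whose trace on some member is not an AP-set can be removed
from every member. -/
theorem IsFilterBase.isAPSet_diff {𝓕 : Set (Set ℕ)} (hbase : IsFilterBase 𝓕)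
    (hAP : ∀ F ∈ 𝓕, IsAPSet F) {S E : Set ℕ} (hE : E ∈ 𝓕) (hS : ¬ IsAPSet (E ∩ S))
    {F : Set ℕ} (hF : F ∈ 𝓕) : IsAPSet (F \ S) := by
  obtain ⟨C, hC, hCsub⟩ := hbase.2 E hE F hF
  have h : IsAPSet ((C ∩ S) ∪ (C \ S)) := by
    rw [inter_union_sdiff]
    exact hAP C hC
  rcases h.or_of_union with h | h
  · exact absurd (h.mono (inter_subset_inter_left S (hCsub.trans inter_subset_left))) hS
  · exact h.mono fun x hx ↦ ⟨(hCsub hx.1).2, hx.2⟩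

/-- The finite sets whose image under `f` has `g`-mass below `1`, ordered by reverse inclusion. -/
abbrev SmallImageFinset (g : ℕ → ℝ) (f : ℕ → ℕ) : Type :=
  {s : Finset ℕ // ∑ n ∈ s.image f, g n < 1}ᵒᵈ

instance (g : ℕ → ℝ) (f : ℕ → ℕ) : Countable (SmallImageFinset g f) :=
  inferInstanceAs (Countable {s : Finset ℕ // ∑ n ∈ s.image f, g n < 1})

instance (g : ℕ → ℝ) (f : ℕ → ℕ) : Nonempty (SmallImageFinset g f) :=
  ⟨OrderDual.toDual ⟨∅, by simp⟩⟩

/-- The finite set underlying a condition. -/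
def SmallImageFinset.toFinset {g : ℕ → ℝ} {f : ℕ → ℕ} (p : SmallImageFinset g f) : Finset ℕ :=
  (OrderDual.ofDual p).1

/-- If removing preimages of finite sets from `F` leaves AP-sets, the conditions containing an
arithmetic progression of length `k` from `F` are dense. -/
theorem posetDense_smallImageFinset {g : ℕ → ℝ} (hgpos : ∀ n, 0 < g n)
    (hg0 : Tendsto g atTop (nhds 0)) {f : ℕ → ℕ} {F : Set ℕ}
    (hF : ∀ K : Finset ℕ, IsAPSet (F \ f ⁻¹' K)) (k : ℕ) :
    PosetDense {p : SmallImageFinset g f |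
      ∃ a d : ℕ, 1 ≤ d ∧ ∀ i < k, a + i * d ∈ F ∩ p.toFinset} := by
  intro p
  set s := p.toFinset
  have hs : ∑ n ∈ s.image f, g n < 1 := (OrderDual.ofDual p).2
  set ε := (1 - ∑ n ∈ s.image f, g n) / (k + 1) with hε
  have hεpos : 0 < ε := div_pos (by linarith) (by positivity)
  obtain ⟨N, hN⟩ := eventually_atTop.1 (hg0.eventually_lt_const hεpos)
  obtain ⟨a, d, hd, hi⟩ := hF (Finset.range N) k
  set t := (Finset.range k).image fun i ↦ a + i * d
  have ht : ∑ n ∈ t.image f, g n ≤ k * ε := by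
    have hcard : (t.image f).card ≤ k :=
      Finset.card_image_le.trans (Finset.card_image_le.trans (Finset.card_range k).le)
    have hle : ∑ n ∈ t.image f, g n ≤ (t.image f).card • ε := by
      refine Finset.sum_le_card_nsmul _ _ _ fun n hn ↦ ?_
      simp only [t, Finset.mem_image, Finset.mem_range] at hn
      obtain ⟨_, ⟨i, hik, rfl⟩, rfl⟩ := hn
      have := (hi i hik).2
      simp only [mem_preimage, Finset.coe_range, mem_Iio, not_lt] at this
      exact (hN _ this).le
    refine hle.trans ?_
    rw [nsmul_eq_mul]
    gcongr
  have hst : ∑ n ∈ (s ∪ t).image f, g n < 1 := by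
    rw [Finset.image_union]
    have hle := Finset.sum_union_inter (s₁ := s.image f) (s₂ := t.image f) (f := g)
    have hnn : 0 ≤ ∑ n ∈ s.image f ∩ t.image f, g n := Finset.sum_nonneg fun n _ ↦ (hgpos n).le
    have hmul : (k + 1) * ε = 1 - ∑ n ∈ s.image f, g n := by rw [hε]; field_simp
    linarith
  refine ⟨OrderDual.toDual ⟨s ∪ t, hst⟩, ⟨a, d, hd, fun i hik ↦ ⟨(hi i hik).1, ?_⟩⟩, ?_⟩
  · exact Finset.mem_union_right _ (Finset.mem_image_of_mem _ (Finset.mem_range.2 hik))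
  · exact Finset.subset_union_left (s₁ := s) (s₂ := t)

/-- The union of a filter of conditions has image of finite `g`-mass. -/
theorem PosetFilter.summable_indicator_image {g : ℕ → ℝ} (hgpos : ∀ n, 0 < g n) {f : ℕ → ℕ}
    {H : Set (SmallImageFinset g f)} (hH : PosetFilter H) :
    Summable ((f '' {n | ∃ p ∈ H, n ∈ p.toFinset}).indicator g) := by
  classical
  set G := {n | ∃ p ∈ H, n ∈ p.toFinset}
  have hcover : ∀ u : Finset ℕ, ∃ p ∈ H, ∀ n ∈ u, n ∈ f '' G → n ∈ p.toFinset.image f := by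
    intro u
    induction u using Finset.induction_on with
    | empty => exact hH.1.imp fun p hp ↦ ⟨hp, by simp⟩
    | insert m u _ ih =>
      obtain ⟨p, hp, hpu⟩ := ih
      by_cases hm : m ∈ f '' G
      · obtain ⟨x, ⟨q, hq, hxq⟩, rfl⟩ := hm
        obtain ⟨r, hr, hrp, hrq⟩ := hH.2.2 p hp q hq
        have hpr : p.toFinset ⊆ r.toFinset := hrp
        have hqr : q.toFinset ⊆ r.toFinset := hrq
        refine ⟨r, hr, fun n hn hnG ↦ ?_⟩
        rcases Finset.mem_insert.1 hn with rfl | hn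
        · exact Finset.mem_image_of_mem f (hqr hxq)
        · exact Finset.image_subset_image hpr (hpu n hn hnG)
      · refine ⟨p, hp, fun n hn hnG ↦ ?_⟩
        rcases Finset.mem_insert.1 hn with rfl | hn
        · exact absurd hnG hm
        · exact hpu n hn hnG
  refine summable_of_sum_le (c := 1) (fun n ↦ indicator_nonneg (fun n _ ↦ (hgpos n).le) n)
    fun u ↦ ?_
  obtain ⟨p, -, hpu⟩ := hcover u
  have hlt : ∑ n ∈ p.toFinset.image f, g n < 1 := (OrderDual.ofDual p).2
  simp only [indicator_apply]
  rw [← Finset.sum_filter]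
  refine (Finset.sum_le_sum_of_subset_of_nonneg (fun n hn ↦ ?_) fun n _ _ ↦ (hgpos n).le).trans
    hlt.le
  exact hpu n (Finset.mem_filter.1 hn).1 (Finset.mem_filter.1 hn).2

/-- Under MA_ctble, a small filter base of AP-sets can be enlarged by an
infinite `G` with `f[G] ∈ I_g` so that all intersections remain AP-sets. -/
theorem exists_G_in_Ig_keeping_APsets (hMA : MActble) (g : ℕ → ℝ) (hgpos : ∀ n, 0 < g n)
    (hgdiv : ¬ Summable g) (hg0 : Filter.Tendsto g Filter.atTop (nhds 0))
    (𝓕 : Set (Set ℕ)) (hbase : IsFilterBase 𝓕) (hcard : #𝓕 < Cardinal.continuum)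
    (hAP : ∀ F ∈ 𝓕, IsAPSet F) (f : ℕ → ℕ) :
    ∃ G : Set ℕ, G.Infinite ∧ Summable ((f '' G).indicator g) ∧
      ∀ F ∈ 𝓕, IsAPSet (F ∩ G) := by
  obtain ⟨E, hE⟩ := hbase.1
  by_cases hK : ∃ K : Finset ℕ, ∀ F ∈ 𝓕, IsAPSet (F ∩ f ⁻¹' K)
  · obtain ⟨K, hK⟩ := hK
    refine ⟨f ⁻¹' K, (hK E hE).infinite.mono inter_subset_right, ?_, hK⟩
    refine summable_of_hasFiniteSupport (K.finite_toSet.subset fun n hn ↦ ?_)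
    exact image_preimage_subset f K (mem_of_indicator_ne_zero hn)
  · push Not at hK
    have hdiff : ∀ F ∈ 𝓕, ∀ K : Finset ℕ, IsAPSet (F \ f ⁻¹' K) := fun F hF K ↦
      let ⟨_, hE', hS⟩ := hK K
      hbase.isAPSet_diff hAP hE' hS hF
    let D : 𝓕 × ℕ → Set (SmallImageFinset g f) := fun x ↦
      {p | ∃ a d : ℕ, 1 ≤ d ∧ ∀ i < x.2, a + i * d ∈ x.1.1 ∩ p.toFinset}
    have hDcard : #(range D) < Cardinal.continuum := by
      refine mk_range_le.trans_lt ?_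
      rw [mk_prod, lift_uzero, lift_uzero, mk_nat]
      exact mul_lt_of_lt aleph0_le_continuum hcard aleph0_lt_continuum
    obtain ⟨H, hH, hHD⟩ := hMA (SmallImageFinset g f) (range D)
      (by
        rintro _ ⟨⟨F, k⟩, rfl⟩
        exact posetDense_smallImageFinset hgpos hg0 (hdiff F F.2) k) hDcard
    have hG : ∀ F ∈ 𝓕, IsAPSet (F ∩ {n | ∃ p ∈ H, n ∈ p.toFinset}) := by
      intro F hF k
      obtain ⟨p, hp, a, d, hd, hi⟩ := hHD _ ⟨(⟨F, hF⟩, k), rfl⟩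
      exact ⟨a, d, hd, fun i hik ↦ ⟨(hi i hik).1, p, hp, (hi i hik).2⟩⟩
    exact ⟨_, (hG E hE).infinite.mono inter_subset_right, hH.summable_indicator_image hgpos, hG⟩
end

section
/- Assume MA_ctble. Then there exists a hereditarily rapid nonprincipal ultrafilter 𝒰 on ℕ such that 𝒰 ∩ 𝒲 = ∅, i.e. every member of 𝒰 is an AP-set; moreover 𝒰 can be taken so that for every g : ℕ → (0, ∞) with Σₙ g(n) = ∞ and limₙ g(n) = 0 and every f : ℕ → ℕ there exists U ∈ 𝒰 with Σ_{a ∈ f[U]} g(a) < ∞. -/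
open Set Filter Cardinal

theorem isAPSet_univ : IsAPSet univ := fun _ => ⟨0, 1, le_rfl, fun _ _ => mem_univ _⟩

theorem not_isAPSet_empty : ¬ IsAPSet ∅ := fun h => by
  obtain ⟨a, d, -, hi⟩ := h 1
  exact hi 0 one_pos

theorem not_isAPSet_singleton (a : ℕ) : ¬ IsAPSet {a} := fun h => by
  obtain ⟨b, d, hd, hi⟩ := h 2
  have h0 := hi 0 (by norm_num)
  have h1 := hi 1 (by norm_num)
  simp only [mem_singleton_iff] at h0 h1
  omega

/-- Van der Waerden's theorem: the AP-sets are partition regular. -/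
theorem IsAPSet.of_union {A B : Set ℕ} (h : IsAPSet (A ∪ B)) : IsAPSet A ∨ IsAPSet B := by
  classical
  by_contra! hAB
  obtain ⟨hA, hB⟩ := hAB
  simp only [IsAPSet, not_forall] at hA hB
  obtain ⟨k₁, hk₁⟩ := hA
  obtain ⟨k₂, hk₂⟩ := hB
  set k := k₁ + k₂ with hk
  obtain ⟨ι, hι, hl⟩ := Combinatorics.Line.exists_mono_in_high_dimension (Fin k) Prop
  obtain ⟨a, d, hd, hi⟩ := h (Fintype.card ι * k + 1)
  obtain ⟨l, c, hc⟩ := hl fun v => a + (∑ i, (v i : ℕ)) * d ∈ A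
  set J : Finset ι := Finset.univ.filter fun i => l.idxFun i = none with hJ
  set b : ℕ := ∑ i, ((l.idxFun i).map Fin.val).getD 0 with hb
  have hsum (x : Fin k) : ∑ i, (l x i : ℕ) = b + x * J.card := by
    rw [mul_comm, ← smul_eq_mul, ← Finset.sum_const, hJ, Finset.sum_filter, hb,
      ← Finset.sum_add_distrib]
    refine Finset.sum_congr rfl fun i _ => ?_
    rcases hx : l.idxFun i with _ | y <;> simp [hx]
  have hJpos : 1 ≤ J.card := by
    obtain ⟨i, hi⟩ := l.proper
    exact Finset.card_pos.2 ⟨i, by simp [hJ, hi]⟩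
  have hmem (x : Fin k) : a + (∑ i, (l x i : ℕ)) * d ∈ A ∪ B := by
    refine hi _ (Nat.lt_succ_of_le ?_)
    calc ∑ i, (l x i : ℕ) ≤ ∑ _i : ι, k := Finset.sum_le_sum fun i _ => (l x i).2.le
      _ = _ := by simp
  have heq (x : Fin k) : a + (∑ i, (l x i : ℕ)) * d = a + b * d + x * (J.card * d) := by
    rw [hsum]; ring
  by_cases hcT : c
  · refine hk₁ ⟨a + b * d, J.card * d, Nat.mul_pos hJpos hd, fun i hik => ?_⟩
    have := hc ⟨i, by omega⟩
    rw [← heq ⟨i, by omega⟩]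
    exact this.mpr hcT
  · refine hk₂ ⟨a + b * d, J.card * d, Nat.mul_pos hJpos hd, fun i hik => ?_⟩
    have := hc ⟨i, by omega⟩
    rw [← heq ⟨i, by omega⟩]
    exact (hmem _).resolve_left fun h' => hcT (this.mp h')

/-- The dual filter of the van der Waerden ideal. -/
def vdWFilter : Filter ℕ where
  sets := {A | ¬ IsAPSet Aᶜ}
  univ_sets := by simpa using not_isAPSet_empty
  sets_of_superset := fun hA h hB => hA (hB.mono (compl_subset_compl.2 h))
  inter_sets := fun {A B} hA hB h => by
    rw [compl_inter] at h
    exact h.of_union.elim hA hB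

theorem mem_vdWFilter {A : Set ℕ} : A ∈ vdWFilter ↔ ¬ IsAPSet Aᶜ := Iff.rfl

theorem isAPSet_of_mem_inf_vdWFilter {F : Filter ℕ} (hF : ∀ A ∈ F, IsAPSet A) {A : Set ℕ}
    (hA : A ∈ F ⊓ vdWFilter) : IsAPSet A := by
  obtain ⟨B, hB, C, hC, rfl⟩ := Filter.mem_inf_iff.1 hA
  have h := hF B hB
  rw [← inter_union_compl B C] at h
  exact h.of_union.resolve_right fun h' => hC (h'.mono inter_subset_right)

/-- A filter of AP-sets extends to an ultrafilter of AP-sets. -/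
theorem exists_ultrafilter_le_of_isAPSet {F : Filter ℕ} (hF : ∀ A ∈ F, IsAPSet A) :
    ∃ 𝒰 : Ultrafilter ℕ, ↑𝒰 ≤ F ∧ ∀ U ∈ 𝒰, IsAPSet U := by
  have : (F ⊓ vdWFilter).NeBot := ⟨fun h => not_isAPSet_empty <|
    isAPSet_of_mem_inf_vdWFilter hF (h ▸ Filter.mem_bot)⟩
  have hle := Ultrafilter.of_le (F ⊓ vdWFilter)
  refine ⟨Ultrafilter.of (F ⊓ vdWFilter), hle.trans inf_le_left, fun U hU => ?_⟩
  by_contra h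
  refine Ultrafilter.compl_mem_iff_notMem.1 (hle (inf_le_right (a := F) ?_)) hU
  rwa [mem_vdWFilter, compl_compl]

/-- `U` is `h`-sparse if `U` has at most `n` elements in `[0, h n]`. -/
def IsSparse (h : ℕ → ℕ) (U : Set ℕ) : Prop := ∀ n, (U ∩ Iic (h n)).ncard ≤ n

theorem lt_nth_of_ncard_le {U : Set ℕ} (hinf : U.Infinite) {m n : ℕ}
    (hU : (U ∩ Iic m).ncard ≤ n) : m < Nat.nth (· ∈ U) n := by
  classical
  refine Nat.lt_of_succ_le ((Nat.count_le_iff_le_nth (p := (· ∈ U)) hinf).1 ?_)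
  rw [Nat.count_eq_card_filter_range, ← ncard_coe_finset]
  refine le_trans (ncard_le_ncard ?_ ((finite_Iic _).inter_of_right _)) hU
  intro x hx
  simp only [Finset.coe_filter, Finset.mem_range, mem_ofPred_eq] at hx
  exact ⟨hx.2, Nat.lt_succ_iff.1 hx.1⟩

/-- There are infinite sparse sets. -/
theorem exists_infinite_isSparse (h : ℕ → ℕ) : ∃ R : Set ℕ, R.Infinite ∧ IsSparse h R := by
  let r : ℕ → ℕ := fun n => (Finset.range (n + 1)).sup h + n + 1
  have hr : StrictMono r := strictMono_nat_of_lt_succ fun n => by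
    have : (Finset.range (n + 1)).sup h ≤ (Finset.range (n + 1 + 1)).sup h :=
      Finset.sup_mono (Finset.range_mono (by omega))
    simp only [r]
    omega
  refine ⟨range r, infinite_range_of_injective hr.injective, fun n => ?_⟩
  have hsub : range r ∩ Iic (h n) ⊆ r '' Iio n := by
    rintro _ ⟨⟨k, rfl⟩, hk⟩
    refine ⟨k, ?_, rfl⟩
    by_contra hkn
    have : h n ≤ (Finset.range (k + 1)).sup h :=
      Finset.le_sup (f := h) (Finset.mem_range.2 (by simp only [mem_Iio] at hkn; omega))
    simp only [mem_Iic, r] at hk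
    omega
  calc _ ≤ (r '' Iio n).ncard := ncard_le_ncard hsub (Set.toFinite _)
    _ ≤ (Iio n).ncard := ncard_image_le (finite_Iio n)
    _ = n := by rw [← Finset.coe_Iio, ncard_coe_finset, Nat.card_Iio]

/-- A set that is sparse enough up to one point has an infinite superset with fast growing
enumeration. -/
theorem exists_superset_le_nth (h : ℕ → ℕ) {C : Set ℕ} {c : ℕ}
    (hC : IsSparse (fun n => (Finset.range (2 * n + 3)).sup h) (C \ {c})) :
    ∃ B, C ⊆ B ∧ B.Infinite ∧ ∀ᶠ n in atTop, h n ≤ Nat.nth (· ∈ B) n := by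
  classical
  set H : ℕ → ℕ := fun n => (Finset.range (2 * n + 3)).sup h with hH
  obtain ⟨R, hR, hRH⟩ := exists_infinite_isSparse H
  let B : Set ℕ := (C \ {c} ∪ {c}) ∪ R
  have hB : B.Infinite := hR.mono subset_union_right
  refine ⟨B, fun x hx => .inl (by by_cases hxc : x = c <;> simp [hx, hxc]), hB, ?_⟩
  filter_upwards [eventually_ge_atTop 1] with n hn
  obtain ⟨m, hm, hm'⟩ : ∃ m, 2 * m + 1 ≤ n ∧ n < 2 * m + 3 := ⟨(n - 1) / 2, by omega, by omega⟩
  have hle : h n ≤ H m := Finset.le_sup (f := h) (Finset.mem_range.2 hm')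
  have hsub : B ∩ Iic (h n) ⊆ ((C \ {c} ∩ Iic (H m)) ∪ {c}) ∪ (R ∩ Iic (H m)) := by
    rintro x ⟨(hx | hx) | hx, hxn⟩
    · exact .inl (.inl ⟨hx, hxn.trans hle⟩)
    · exact .inl (.inr hx)
    · exact .inr ⟨hx, hxn.trans hle⟩
  refine (lt_nth_of_ncard_le hB ?_).le
  calc _ ≤ _ := ncard_le_ncard hsub ((((finite_Iic _).inter_of_right _).union
          (finite_singleton c)).union ((finite_Iic _).inter_of_right _))
    _ ≤ _ := ncard_union_le _ _
    _ ≤ (m + 1) + m := by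
      gcongr
      · refine (ncard_union_le _ _).trans ?_
        rw [ncard_singleton]
        exact Nat.add_le_add_right (hC m) 1
      · exact hRH m
    _ ≤ n := by omega

/-- The poset of finite sets with `h`-sparse image under `f`, ordered by reverse inclusion. -/
abbrev SparseApprox (f h : ℕ → ℕ) : Type := {s : Finset ℕ // IsSparse h (f '' s)}ᵒᵈ

theorem exists_isSparse_of_MActble (hMA : MActble) (f h : ℕ → ℕ) (S : Set (Set ℕ))
    (hS : #S < continuum)
    (hAP : ∀ t ⊆ S, t.Finite → ∀ N, IsAPSet (⋂₀ t ∩ f ⁻¹' Ioi N)) :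
    ∃ U, IsSparse h (f '' U) ∧ ∀ t ⊆ S, t.Finite → IsAPSet (⋂₀ t ∩ U) := by
  classical
  let D : Finset S × ℕ → Set (SparseApprox f h) := fun x =>
    {s | ∃ a d : ℕ, 1 ≤ d ∧ ∀ i < x.2, a + i * d ∈ (⋂ A ∈ x.1, (A : Set ℕ)) ∩ s.ofDual.1}
  have : Countable (SparseApprox f h) :=
    inferInstanceAs (Countable {s : Finset ℕ // IsSparse h (f '' s)})
  have hne : Nonempty (SparseApprox f h) := ⟨OrderDual.toDual ⟨∅, fun n => by simp⟩⟩
  have hdense : ∀ E ∈ range D, PosetDense E := by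
    rintro _ ⟨⟨t, k⟩, rfl⟩ s
    obtain ⟨s, hs⟩ := s
    obtain ⟨a, d, hd, hi⟩ := hAP ((↑) '' (t : Set S)) (by rintro _ ⟨x, -, rfl⟩; exact x.2)
      (t.finite_toSet.image _) ((Finset.range (s.card + k)).sup h) k
    let r : Finset ℕ := (Finset.range k).image fun i => a + i * d
    have hr : IsSparse h (f '' ↑(s ∪ r)) := by
      intro n
      rcases le_or_gt (s.card + k) n with hn | hn
      · calc _ ≤ (f '' ↑(s ∪ r)).ncard := ncard_le_ncard inter_subset_left (Set.toFinite _)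
          _ ≤ (↑(s ∪ r) : Set ℕ).ncard := ncard_image_le (Set.toFinite _)
          _ = (s ∪ r).card := ncard_coe_finset _
          _ ≤ s.card + r.card := Finset.card_union_le _ _
          _ ≤ s.card + k := by
            gcongr
            exact Finset.card_image_le.trans (by simp)
          _ ≤ n := hn
      · refine le_trans (ncard_le_ncard ?_ (Set.toFinite _)) (hs n)
        rintro _ ⟨⟨x, hx, rfl⟩, hxn⟩
        refine ⟨?_, hxn⟩
        rcases Finset.mem_union.1 (Finset.mem_coe.1 hx) with hx | hx
        · exact ⟨x, hx, rfl⟩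
        · obtain ⟨i, hik, rfl⟩ := Finset.mem_image.1 hx
          have h1 := (hi i (Finset.mem_range.1 hik)).2
          have h2 : h n ≤ (Finset.range (s.card + k)).sup h :=
            Finset.le_sup (f := h) (Finset.mem_range.2 hn)
          simp only [mem_preimage, mem_Ioi, mem_Iic] at h1 hxn
          omega
    refine ⟨OrderDual.toDual ⟨s ∪ r, hr⟩, ⟨a, d, hd, fun i hik => ⟨?_, ?_⟩⟩, ?_⟩
    · simpa using (hi i hik).1
    · exact Finset.mem_union_right _ (Finset.mem_image.2 ⟨i, Finset.mem_range.2 hik, rfl⟩)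
    · exact Finset.subset_union_left (s₁ := s) (s₂ := r)
  have hcard : #(range D) < continuum := by
    refine mk_range_le.trans_lt ?_
    rw [mk_prod, lift_id, lift_id]
    refine mul_lt_of_lt aleph0_le_continuum ?_ (by simpa using aleph0_lt_continuum)
    rcases finite_or_infinite S with hfin | hinf
    · exact (lt_aleph0_of_finite _).trans aleph0_lt_continuum
    · rwa [mk_finset_of_infinite]
  obtain ⟨G, ⟨hGne, -, hGdir⟩, hG⟩ := hMA (SparseApprox f h) (range D) hdense hcard
  let U : Set ℕ := ⋃ s ∈ G, (s.ofDual.1 : Set ℕ)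
  have hfin (r : Set ℕ) (hr : r.Finite) : r ⊆ U → ∃ s ∈ G, r ⊆ (s.ofDual.1 : Set ℕ) := by
    induction r, hr using Set.Finite.induction_on with
    | empty => exact fun _ => hGne.imp fun s hs => ⟨hs, empty_subset _⟩
    | insert _ _ ih =>
      intro hU
      obtain ⟨hx, hr⟩ := insert_subset_iff.1 hU
      obtain ⟨s, hs, hsr⟩ := ih hr
      obtain ⟨p, hp, hxp⟩ := mem_iUnion₂.1 hx
      obtain ⟨q, hq, hqs, hqp⟩ := hGdir s hs p hp
      exact ⟨q, hq, insert_subset_iff.2 ⟨hqp hxp, hsr.trans hqs⟩⟩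
  refine ⟨U, fun n => ?_, fun t htS ht k => ?_⟩
  · obtain ⟨r, hrU, hr⟩ := (exists_subset_image_finite_and (p := (· = f '' U ∩ Iic (h n)))).1
      ⟨f '' U ∩ Iic (h n), inter_subset_left, (finite_Iic _).inter_of_right _, rfl⟩
    obtain ⟨s, hs, hrs⟩ := hfin r hr.1 hrU
    refine le_trans (ncard_le_ncard ?_ (Set.toFinite _)) (s.ofDual.2 n)
    exact fun x hx => ⟨image_mono hrs (hr.2 ▸ hx), hx.2⟩
  · obtain ⟨s, hs, a, d, hd, hi⟩ := hG _ ⟨(ht.toFinset.subtype (· ∈ S), k), rfl⟩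
    refine ⟨a, d, hd, fun i hik => ⟨?_, mem_iUnion₂.2 ⟨s, hs, (hi i hik).2⟩⟩⟩
    have := (hi i hik).1
    simp only [mem_iInter] at this
    exact fun A hA => this ⟨A, htS hA⟩ (by simpa using hA)

/-- A small family generating a filter of AP-sets can be enlarged by a set whose image is, up to
one point, sparse. -/
theorem exists_isSparse_insert (hMA : MActble) (f h : ℕ → ℕ) (S : Set (Set ℕ))
    (hS : #S < continuum) (hAP : ∀ A ∈ Filter.generate S, IsAPSet A) :
    ∃ U, (∃ n, IsSparse h (f '' U \ {n})) ∧
      ∀ A ∈ Filter.generate (insert U S), IsAPSet A := by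
  have key (U : Set ℕ) (hU : ∀ t ⊆ S, t.Finite → IsAPSet (⋂₀ t ∩ U)) :
      ∀ A ∈ Filter.generate (insert U S), IsAPSet A := by
    intro A hA
    obtain ⟨t, htS, ht, htA⟩ := Filter.mem_generate_iff.1 hA
    refine (hU (t \ {U}) ?_ ht.sdiff).mono (Subset.trans ?_ htA)
    · exact fun B hB => (htS hB.1).resolve_left hB.2
    · intro x hx B hB
      by_cases hBU : B = U
      · exact hBU ▸ hx.2
      · exact hx.1 B ⟨hB, hBU⟩
  have hgen (t : Set (Set ℕ)) (htS : t ⊆ S) (ht : t.Finite) : ⋂₀ t ∈ Filter.generate S :=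
    Filter.mem_generate_iff.2 ⟨t, htS, ht, Subset.rfl⟩
  by_cases hc : ∃ n, ∀ A ∈ Filter.generate S, IsAPSet (A ∩ f ⁻¹' {n})
  · obtain ⟨n, hn⟩ := hc
    refine ⟨f ⁻¹' {n}, ⟨n, fun m => ?_⟩, key _ fun t htS ht => hn _ (hgen t htS ht)⟩
    rw [sdiff_eq_empty.2 (image_preimage_subset f {n})]
    simp
  · push Not at hc
    have hn (n : ℕ) : (f ⁻¹' {n})ᶜ ∈ Filter.generate S ⊓ vdWFilter := by
      obtain ⟨A, hA, hA'⟩ := hc n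
      refine Filter.mem_of_superset (Filter.inter_mem_inf hA
        (mem_vdWFilter (A := (A ∩ f ⁻¹' {n})ᶜ).2 (by rwa [compl_compl]))) ?_
      exact fun x hx hxn => hx.2 ⟨hx.1, hxn⟩
    have hN (N : ℕ) : f ⁻¹' Ioi N ∈ Filter.generate S ⊓ vdWFilter := by
      refine Filter.mem_of_superset ((Filter.biInter_mem (finite_Iic N)).2 fun n _ => hn n) ?_
      intro x hx
      by_contra hxN
      exact mem_iInter₂.1 hx (f x) (mem_Iic.2 (le_of_not_gt hxN)) rfl
    obtain ⟨U, hU, hU'⟩ := exists_isSparse_of_MActble hMA f h S hS fun t htS ht N =>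
      isAPSet_of_mem_inf_vdWFilter hAP
        (Filter.inter_mem (Filter.mem_inf_of_left (hgen t htS ht)) (hN N))
    refine ⟨U, ⟨0, fun n => (ncard_le_ncard ?_ ((finite_Iic _).inter_of_right _)).trans (hU n)⟩,
      key U hU'⟩
    exact inter_subset_inter_left _ sdiff_subset

/-- If each requirement `P t` can be met by enlarging any small family generating a filter of
AP-sets, then all requirements are met by one family generating a filter of AP-sets. -/
theorem exists_family_of_insert {T : Type} (P : T → Set ℕ → Prop)
    (hstep : ∀ (t : T) (S : Set (Set ℕ)), #S < #T → (∀ A ∈ Filter.generate S, IsAPSet A) →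
      ∃ U, P t U ∧ ∀ A ∈ Filter.generate (insert U S), IsAPSet A) :
    ∃ S : Set (Set ℕ), (∀ A ∈ Filter.generate S, IsAPSet A) ∧ ∀ t, ∃ U ∈ S, P t U := by
  classical
  obtain ⟨r, hwo, hr⟩ := Cardinal.exists_ord_eq T
  let : LinearOrder T := linearOrderOfSTO r
  have hwf : WellFounded ((· < ·) : T → T → Prop) := hwo.wf
  let Q (t : T) (S : Set (Set ℕ)) (U : Set ℕ) : Prop :=
    P t U ∧ ∀ A ∈ Filter.generate (insert U S), IsAPSet A
  let V : T → Set ℕ := hwf.fix fun t ih =>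
    Classical.epsilon (Q t (range fun s : Iio t => ih s.1 s.2))
  have hV (t : T) : V t = Classical.epsilon (Q t (V '' Iio t)) := by
    rw [image_eq_range]
    exact hwf.fix_eq _ t
  have hsmall (t : T) : #(V '' Iio t) < #T :=
    mk_image_le.trans_lt (card_typein_lt (r := r) t hr)
  have hfinite (J : Set T) (hJ : ∀ t ∈ J, Q t (V '' Iio t) (V t)) :
      ∀ A ∈ Filter.generate (V '' J), IsAPSet A := by
    intro A hA
    obtain ⟨K, hKJ, hK, hKA⟩ := exists_subset_image_finite_and.1 (Filter.mem_generate_iff.1 hA)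
    rcases K.eq_empty_or_nonempty with rfl | hne
    · exact isAPSet_univ.mono (by simpa using hKA)
    · obtain ⟨t, htK, ht⟩ := K.exists_max_image id hK hne
      refine (hJ t (hKJ htK)).2 A (Filter.mem_generate_iff.2 ⟨V '' K, ?_, hK.image _, hKA⟩)
      rintro _ ⟨s, hs, rfl⟩
      rcases (ht s hs).eq_or_lt with h | h
      · exact .inl (congrArg V h)
      · exact .inr ⟨s, h, rfl⟩
  have hQ (t : T) : Q t (V '' Iio t) (V t) := by
    induction t using hwf.induction with
    | _ t ih =>
      rw [hV t]
      exact Classical.epsilon_spec (hstep t _ (hsmall t) (hfinite _ ih))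
  exact ⟨V '' univ, hfinite univ fun t _ => hQ t, fun t => ⟨V t, ⟨t, mem_univ t, rfl⟩, (hQ t).1⟩⟩

/-- A function tending to zero is summable along a suitable image set if the image ultrafilter
is rapid. -/
theorem IsRapid.exists_summable_indicator {𝒰 : Ultrafilter ℕ} (h𝒰 : IsRapid 𝒰) {g : ℕ → ℝ}
    (hg : ∀ n, 0 < g n) (hlim : Tendsto g atTop (nhds 0)) :
    ∃ B ∈ 𝒰, Summable (B.indicator g) := by
  have hex (n : ℕ) : ∃ m, ∀ k ≥ m, g k < (1 / 2 : ℝ) ^ n :=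
    eventually_atTop.1 (hlim.eventually_lt_const (by positivity))
  choose h hh using hex
  obtain ⟨B, hB, hinf, hBh⟩ := h𝒰 h
  refine ⟨B, hB, ?_⟩
  have hinf' : (Set.ofPred (· ∈ B)).Infinite := hinf
  rw [← (Nat.nth_injective hinf').summable_iff fun x hx => indicator_of_notMem (fun hxB => hx ?_) g]
  · refine Summable.of_norm_bounded_eventually_nat summable_geometric_two ?_
    filter_upwards [hBh] with n hn
    have hmem : Nat.nth (· ∈ B) n ∈ B := Nat.nth_mem_of_infinite hinf' n
    rw [Function.comp_apply, indicator_of_mem hmem, Real.norm_of_nonneg (hg _).le]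
    exact (hh n _ hn).le
  · rw [Nat.range_nth_of_infinite hinf']
    exact hxB

/-- Under MA_ctble there is a hereditarily rapid ultrafilter disjoint from the
van der Waerden ideal; it is an `I_g`-ultrafilter for every tall summable ideal. -/
theorem exists_hereditarilyRapid_disjoint_from_W (hMA : MActble) :
    ∃ 𝒰 : Ultrafilter ℕ, (∀ a : ℕ, 𝒰 ≠ pure a) ∧ IsHereditarilyRapid 𝒰 ∧
      (∀ U ∈ 𝒰, IsAPSet U) ∧
      ∀ g : ℕ → ℝ, (∀ n, 0 < g n) → ¬ Summable g →
        Filter.Tendsto g Filter.atTop (nhds 0) →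
        ∀ f : ℕ → ℕ, ∃ U ∈ 𝒰, Summable ((f '' U).indicator g) := by
  obtain ⟨S, hS, hST⟩ := exists_family_of_insert (T := (ℕ → ℕ) × (ℕ → ℕ))
    (fun t U => ∃ n, IsSparse t.2 (t.1 '' U \ {n})) fun t S hS hAP =>
      exists_isSparse_insert hMA t.1 t.2 S (by simpa using hS) hAP
  obtain ⟨𝒰, hle, h𝒰⟩ := exists_ultrafilter_le_of_isAPSet hS
  have hrapid (f : ℕ → ℕ) : IsRapid (𝒰.map f) := by
    intro h
    obtain ⟨U, hU, n, hn⟩ := hST (f, fun n => (Finset.range (2 * n + 3)).sup h)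
    obtain ⟨B, hUB, hB⟩ := exists_superset_le_nth h hn
    have hU𝒰 : U ∈ 𝒰 := hle (Filter.mem_generate_of_mem hU)
    have hUB' : U ⊆ f ⁻¹' B := image_subset_iff.1 hUB
    exact ⟨B, Ultrafilter.mem_map.2 (mem_of_superset hU𝒰 hUB'), hB⟩
  refine ⟨𝒰, ?_, ⟨by simpa using hrapid id, hrapid⟩, h𝒰, fun g hg _ hlim f => ?_⟩
  · rintro a rfl
    exact not_isAPSet_singleton a (h𝒰 _ (mem_singleton a))
  · obtain ⟨B, hB, hsum⟩ := (hrapid f).exists_summable_indicator hg hlim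
    refine ⟨f ⁻¹' B, hB, ?_⟩
    have := hsum.indicator (f '' (f ⁻¹' B))
    rwa [indicator_indicator, inter_eq_left.2 (image_preimage_subset f B)] at this
end

section
/- The van der Waerden ideal is not a P-ideal: the sets Aₙ = {2^i + n : i ∈ ℕ} (for n ∈ ℕ) are not AP-sets (indeed each Aₙ contains no 3-term arithmetic progression), yet every set A ⊆ ℕ such that Aₙ ∖ A is finite for all n ∈ ℕ is an AP-set. -/
open Set Filter Cardinal

theorem IsAPSet.has3AP {A : Set ℕ} (h : IsAPSet A) : Has3AP A := by
  obtain ⟨a, d, hd, h⟩ := h 3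
  exact ⟨a, d, hd, by simpa using h 0, by simpa using h 1, h 2 (by norm_num)⟩

theorem not_has3AP_two_pow_add (n : ℕ) : ¬ Has3AP {m : ℕ | ∃ i : ℕ, m = 2 ^ i + n} := by
  rintro ⟨a, d, hd, ⟨i, hi⟩, ⟨j, hj⟩, ⟨k, hk⟩⟩
  have hjk : j < k := (Nat.pow_lt_pow_iff_right Nat.one_lt_two).1 (by omega)
  have hle : 2 ^ (j + 1) ≤ 2 ^ k := Nat.pow_le_pow_right two_pos hjk
  have hpos : 0 < 2 ^ i := Nat.two_pow_pos i
  rw [pow_succ] at hle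
  omega

theorem isAPSet_of_finite_two_pow_add_diff {A : Set ℕ}
    (hA : ∀ n : ℕ, ({m : ℕ | ∃ i : ℕ, m = 2 ^ i + n} \ A).Finite) : IsAPSet A := by
  intro k
  obtain ⟨N, hN⟩ := ((Set.finite_lt_nat k).biUnion fun n _ => hA n).bddAbove
  refine ⟨2 ^ N, 1, le_rfl, fun n hn => ?_⟩
  by_contra hmem
  rw [mul_one] at hmem
  have hle : 2 ^ N + n ≤ N := hN (Set.mem_biUnion (show n ∈ {i | i < k} from hn) ⟨⟨N, rfl⟩, hmem⟩)
  have hlt : N < 2 ^ N := Nat.lt_two_pow_self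
  omega

/-- The van der Waerden ideal is not a P-ideal, as witnessed by the sets
`Aₙ = {2^i + n : i ∈ ℕ}`. -/
theorem vdW_not_Pideal :
    (∀ n : ℕ, ¬ Has3AP {m : ℕ | ∃ i : ℕ, m = 2 ^ i + n}) ∧
      (∀ n : ℕ, ¬ IsAPSet {m : ℕ | ∃ i : ℕ, m = 2 ^ i + n}) ∧
      ∀ A : Set ℕ,
        (∀ n : ℕ, ({m : ℕ | ∃ i : ℕ, m = 2 ^ i + n} \ A).Finite) → IsAPSet A := by
  exact ⟨not_has3AP_two_pow_add, fun n h => not_has3AP_two_pow_add n h.has3AP,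
    fun _ => isAPSet_of_finite_two_pow_add_diff⟩
end
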